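/- In a marked proper free-choice net (N,M) having a home cluster C, no reachable marking strictly dominates the home cluster marking: for all M' ∈ R(N,M), if M' ≥ Mrk(C) (pointwise as multisets) then M' = Mrk(C). -/

import Mathlib

open scoped Classical

/-- A Petri net over places `P` and transitions `T`, given by preset and postset
of each transition (this encodes the flow relation `F`). -/
structure PetriNet (P T : Type) where
  pre : T → Finset P
  post : T → Finset P

namespace PetriNet

variable {P T : Type} [DecidableEq P] (N : PetriNet P T)

/-- A transition is enabled if each input place holds at least one token. -/
def enabled (M : P → ℕ) (t : T) : Prop := ∀ p ∈ N.pre t, 1 ≤ M p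

/-- Firing a transition. -/
def fire (M : P → ℕ) (t : T) : P → ℕ :=
  fun p => M p - (if p ∈ N.pre t then 1 else 0) + (if p ∈ N.post t then 1 else 0)

/-- `Fires M σ M'` : the firing sequence σ is enabled in M and leads to M'. -/
inductive Fires : (P → ℕ) → List T → (P → ℕ) → Prop
  | nil (M : P → ℕ) : Fires M [] M
  | cons {M : P → ℕ} {t : T} {σ : List T} {M'' : P → ℕ} :
      N.enabled M t → Fires (N.fire M t) σ M'' → Fires M (t :: σ) M''

/-- Reachability of markings. -/
def Reach (M M' : P → ℕ) : Prop := ∃ σ : List T, N.Fires M σ M'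

/-- The set of transitions enabled in a marking. -/
def en (M : P → ℕ) : Set T := {t | N.enabled M t}

/-- Lucency: reachable markings are determined by their sets of enabled transitions. -/
def Lucent (M : P → ℕ) : Prop :=
  ∀ M1 M2 : P → ℕ, N.Reach M M1 → N.Reach M M2 → N.en M1 = N.en M2 → M1 = M2

/-- Free-choice: presets of any two transitions are equal or disjoint. -/
def FreeChoice : Prop :=
  ∀ t1 t2 : T, N.pre t1 = N.pre t2 ∨ N.pre t1 ∩ N.pre t2 = ∅

/-- Proper: every transition has a nonempty preset and postset. -/
def Proper : Prop := ∀ t : T, (N.pre t).Nonempty ∧ (N.post t).Nonempty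

/-- The directed edge (flow) relation on nodes `P ⊕ T`. -/
def edge : (P ⊕ T) → (P ⊕ T) → Prop
  | Sum.inl p, Sum.inr t => p ∈ N.pre t
  | Sum.inr t, Sum.inl p => p ∈ N.post t
  | _, _ => False

/-- `InCluster x y` : y is in the cluster of x (smallest set containing x closed
under adding output transitions of places and input places of transitions). -/
inductive InCluster : (P ⊕ T) → (P ⊕ T) → Prop
  | refl (x : P ⊕ T) : InCluster x x
  | toTrans {x : P ⊕ T} {p : P} {t : T} :
      InCluster x (Sum.inl p) → p ∈ N.pre t → InCluster x (Sum.inr t)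
  | toPlace {x : P ⊕ T} {t : T} {p : P} :
      InCluster x (Sum.inr t) → p ∈ N.pre t → InCluster x (Sum.inl p)

/-- The cluster of a node. -/
def cluster (x : P ⊕ T) : Set (P ⊕ T) := {y | N.InCluster x y}

/-- A set of nodes is a cluster if it is the cluster of some node. -/
def IsCluster (C : Set (P ⊕ T)) : Prop := ∃ x : P ⊕ T, C = N.cluster x

/-- `Mrk(C)` : one token on each place of `C`, no tokens elsewhere. -/
noncomputable def clusterMrk (C : Set (P ⊕ T)) : P → ℕ :=
  fun p => if Sum.inl p ∈ C then 1 else 0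

/-- A home marking is reachable from every reachable marking. -/
def IsHomeMarking (M MH : P → ℕ) : Prop := ∀ M', N.Reach M M' → N.Reach M' MH

/-- A home cluster is a cluster whose marking `Mrk(C)` is a home marking. -/
def HomeCluster (M : P → ℕ) (C : Set (P ⊕ T)) : Prop :=
  N.IsCluster C ∧ N.IsHomeMarking M (PetriNet.clusterMrk C)

/-- A conflict-pair for `(N,M)`. -/
def ConflictPair (M M1 M2 : P → ℕ) : Prop :=
  N.Reach M M1 ∧ N.Reach M M2 ∧
  (∃ t, N.enabled M1 t) ∧ (∃ t, N.enabled M2 t) ∧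
  (∀ t, ¬ (N.enabled M1 t ∧ N.enabled M2 t)) ∧
  (∀ t, N.enabled M1 t → ∃ p ∈ N.pre t, 1 ≤ M2 p) ∧
  (∀ t, N.enabled M2 t → ∃ p ∈ N.pre t, 1 ≤ M1 p)

/-- A disentangled path `⟨p_1,t_1,p_2,…,t_{n-1},p_n⟩`, given by its lists of
places and transitions: consecutive nodes are connected by the flow relation and
all places lie in pairwise distinct clusters. -/
def IsDisPath (ps : List P) (ts : List T) : Prop :=
  ps.length = ts.length + 1 ∧
  (∀ (i : ℕ) (t : T) (p p' : P), ts[i]? = some t → ps[i]? = some p →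
      ps[i + 1]? = some p' → p ∈ N.pre t ∧ p' ∈ N.post t) ∧
  ps.Pairwise (fun a b => N.cluster (Sum.inl a) ≠ N.cluster (Sum.inl b))

/-- `Exp M σ σ'` : σ' is obtained from σ by repeatedly expediting transitions
(moving the transition at position j to an earlier position i, provided the
prefix of length i followed by that transition is enabled from M and no
transition at positions i..j-1 shares its cluster). -/
inductive Exp (M : P → ℕ) (σ : List T) : List T → Prop
  | refl : Exp M σ σ
  | step {σ' : List T} {i j : ℕ} (h : Exp M σ σ') (hij : i < j) (hj : j < σ'.length)
      (ha : ∃ Mx, N.Fires M (σ'.take i ++ [σ'.get ⟨j, hj⟩]) Mx)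
      (hb : ∀ (k : ℕ) (hk : k < σ'.length), i ≤ k → k < j →
        N.cluster (Sum.inr (σ'.get ⟨k, hk⟩)) ≠ N.cluster (Sum.inr (σ'.get ⟨j, hj⟩))) :
      Exp M σ ((σ'.eraseIdx j).insertIdx i (σ'.get ⟨j, hj⟩))

/-- Liveness: from every reachable marking, every transition can be enabled again. -/
def Live (M : P → ℕ) : Prop :=
  ∀ M', N.Reach M M' → ∀ t : T, ∃ M'', N.Reach M' M'' ∧ N.enabled M'' t

/-- Boundedness. -/
def Bounded (M : P → ℕ) : Prop :=
  ∃ k, ∀ M', N.Reach M M' → ∀ p, M' p ≤ k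

/-- Safety (1-boundedness). -/
def Safe (M : P → ℕ) : Prop := ∀ M', N.Reach M M' → ∀ p, M' p ≤ 1

end PetriNet

namespace PetriNet

section Helpers
variable {P T : Type} [DecidableEq P] (N : PetriNet P T)

theorem aux_disj (hfc : N.FreeChoice) {s t : T} (h : N.pre s ≠ N.pre t) (p : P)
    (hs : p ∈ N.pre s) (ht : p ∈ N.pre t) : False := by
  rcases hfc s t with h1 | h1
  · exact h h1
  · have : p ∈ N.pre s ∩ N.pre t := Finset.mem_inter.2 ⟨hs, ht⟩
    rw [h1] at this
    simp at this

theorem aux_fire_of_not_mem (A : P → ℕ) (t : T) (p : P) (h : p ∉ N.pre t) :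
    A p ≤ N.fire A t p := by
  unfold fire
  rw [if_neg h]
  omega

theorem aux_enabled_fire {A : P → ℕ} {s t : T} (h : ∀ p, p ∈ N.pre s → p ∈ N.pre t → False)
    (ht : N.enabled A t) : N.enabled (N.fire A s) t := fun p hp =>
  (ht p hp).trans (aux_fire_of_not_mem N A s p (fun h' => h p h' hp))

theorem aux_comm {A : P → ℕ} {s t : T} (h : ∀ p, p ∈ N.pre s → p ∈ N.pre t → False)
    (hs : N.enabled A s) (ht : N.enabled A t) :
    N.fire (N.fire A s) t = N.fire (N.fire A t) s := by
  funext p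
  have h1 := h p
  have h2 := hs p
  have h3 := ht p
  unfold fire
  by_cases a : p ∈ N.pre s <;> by_cases b : p ∈ N.pre t <;> simp only [a, b, if_true, if_false] <;>
    simp only [a, b] at h1 h2 h3 <;> first | (exact absurd trivial (fun _ => h1 trivial trivial)) | skip
  all_goals (try have h2 := h2 trivial)
  all_goals (try have h3 := h3 trivial)
  all_goals omega

theorem aux_expedite (Z : P → ℕ) (t : T) (β : List T) : ∀ (α : List T) (B : P → ℕ),
    N.Fires B (α ++ t :: β) Z → N.enabled B t →
    (∀ s ∈ α, ∀ p, p ∈ N.pre s → p ∈ N.pre t → False) →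
    N.Fires (N.fire B t) (α ++ β) Z
  | [], B, h, _, _ => by
      cases h with
      | cons h1 h2 => exact h2
  | s :: α, B, h, ht, hd => by
      cases h with
      | cons h1 h2 =>
        have hst := hd s (by simp)
        have ih := aux_expedite Z t β α _ h2 (aux_enabled_fire N hst ht)
          (fun s' hs' => hd s' (by simp [hs']))
        rw [aux_comm N hst h1 ht] at ih
        exact Fires.cons (aux_enabled_fire N (fun p a b => hst p b a) h1) ih

theorem aux_fires_mono {p : P} {B Z : P → ℕ} {σ : List T} (h : N.Fires B σ Z)
    (hd : ∀ s ∈ σ, p ∉ N.pre s) : B p ≤ Z p := by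
  induction h with
  | nil => exact le_rfl
  | cons _ _ ih =>
    exact (aux_fire_of_not_mem N _ _ p (hd _ (by simp))).trans
      (ih (fun s hs => hd s (by simp [hs])))

theorem aux_fires_append {A B Z : P → ℕ} {σ τ : List T} (h : N.Fires A σ B)
    (h2 : N.Fires B τ Z) : N.Fires A (σ ++ τ) Z := by
  induction h with
  | nil => exact h2
  | cons a _ ih => exact Fires.cons a (ih h2)

theorem aux_nil (hp : N.Proper) (C : Set (P ⊕ T)) {B Z : P → ℕ} {σ : List T}
    (h : N.Fires B σ Z) (hZ : Z = clusterMrk C) (hB : ∀ p, clusterMrk C p ≤ B p)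
    (hd : ∀ s ∈ σ, ∀ p ∈ N.pre s, Sum.inl p ∉ C) : σ = [] := by
  induction h with
  | nil => rfl
  | @cons A t σ Z h1 h2 ih =>
    exfalso
    have hge : ∀ p, clusterMrk C p ≤ N.fire A t p := by
      intro p
      by_cases hpt : p ∈ N.pre t
      · have := hd t (by simp) p hpt
        simp [clusterMrk, this]
      · exact (hB p).trans (aux_fire_of_not_mem N A t p hpt)
    have hn := ih hZ hge (fun s hs => hd s (by simp [hs]))
    subst hn
    have hZ' : N.fire A t = clusterMrk C := by
      cases h2
      exact hZ
    obtain ⟨q, hq⟩ := (hp t).2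
    have h3 := congrFun hZ' q
    have h4 := hB q
    have h5 := hd t (by simp) q
    unfold fire at h3
    rw [if_pos hq] at h3
    unfold clusterMrk at h3 h4
    by_cases hqC : Sum.inl q ∈ C
    · have h6 : q ∉ N.pre t := fun h => h5 h hqC
      rw [if_neg h6] at h3
      rw [if_pos hqC] at h3 h4
      omega
    · rw [if_neg hqC] at h3
      omega

/-- Membership of a node in the preset class of `t`. -/
def auxClass (t : T) : (P ⊕ T) → Prop
  | Sum.inl p => p ∈ N.pre t
  | Sum.inr s => N.pre s = N.pre t

theorem aux_class (hfc : N.FreeChoice) (t : T) {x y : P ⊕ T} (h : N.InCluster x y) :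
    auxClass N t x ↔ auxClass N t y := by
  have key : ∀ (p : P) (s : T), p ∈ N.pre s → (p ∈ N.pre t ↔ N.pre s = N.pre t) := by
    intro p s hps
    constructor
    · intro h
      by_contra hne
      exact aux_disj N hfc hne p hps h
    · intro h
      rw [← h]
      exact hps
  induction h with
  | refl => exact Iff.rfl
  | toTrans _ h ih => exact ih.trans (key _ _ h)
  | toPlace _ h ih => exact ih.trans (key _ _ h).symm

theorem aux_pre_eq (hfc : N.FreeChoice) {C : Set (P ⊕ T)} (hC : N.IsCluster C) {t : T} {q : P}
    (hq : q ∈ N.pre t) (hqC : Sum.inl q ∈ C) (p : P) : Sum.inl p ∈ C ↔ p ∈ N.pre t := by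
  obtain ⟨x, rfl⟩ := hC
  constructor
  · intro hpC
    exact (aux_class N hfc t hpC).1 ((aux_class N hfc t hqC).2 hq)
  · intro hpt
    exact InCluster.toPlace (InCluster.toTrans hqC hq) hpt

theorem aux_first (t : T) (σ : List T) (h : ∃ s ∈ σ, N.pre s = N.pre t) :
    ∃ α s β, σ = α ++ s :: β ∧ N.pre s = N.pre t ∧ ∀ r ∈ α, N.pre r ≠ N.pre t := by
  induction σ with
  | nil => simp at h
  | cons a σ ih =>
    by_cases ha : N.pre a = N.pre t
    · exact ⟨[], a, σ, rfl, ha, by simp⟩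
    · obtain ⟨s, hs, hst⟩ := h
      rcases List.mem_cons.1 hs with rfl | hs
      · exact absurd hst ha
      · obtain ⟨α, s', β, e, h1, h2⟩ := ih ⟨s, hs, hst⟩
        refine ⟨a :: α, s', β, by rw [e]; rfl, h1, ?_⟩
        intro r hr
        rcases List.mem_cons.1 hr with rfl | hr
        · exact ha
        · exact h2 r hr

theorem aux_fire_le {A B : P → ℕ} (t : T) (h : ∀ p, A p ≤ B p) (p : P) :
    N.fire A t p ≤ N.fire B t p := by
  have := h p
  unfold fire
  omega

theorem aux_fire_inj {A B : P → ℕ} {t : T} (hA : N.enabled A t) (hB : N.enabled B t)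
    (h : N.fire B t = N.fire A t) : B = A := by
  funext p
  have h1 := congrFun h p
  have h2 := hA p
  have h3 := hB p
  unfold fire at h1
  by_cases hp : p ∈ N.pre t
  · have := h2 hp
    have := h3 hp
    rw [if_pos hp] at h1
    omega
  · rw [if_neg hp] at h1
    omega

theorem aux_main (hp : N.Proper) (hfc : N.FreeChoice) {C : Set (P ⊕ T)} (hC : N.IsCluster C)
    (hh : N.IsHomeMarking (clusterMrk C) (clusterMrk C)) :
    ∀ (n : ℕ) (σ : List T) (A B : P → ℕ), σ.length = n → (∀ p, A p ≤ B p) →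
      N.Reach (clusterMrk C) A → N.Fires B σ (clusterMrk C) → B = A := by
  intro n
  induction n with
  | zero | succ n ih => ?_
  all_goals
    intro σ A B hn hAB hA hB
    by_cases hex : ∃ u, N.enabled A u ∧ ∃ s ∈ σ, N.pre s = N.pre u
    · obtain ⟨u, hu, hs⟩ := hex
      obtain ⟨α, t, β, rfl, htu, hα⟩ := aux_first N u σ hs
      first
      | (simp at hn; done)
      | (have htA : N.enabled A t := by
           intro p hp
           rw [htu] at hp
           exact hu p hp
         have htB : N.enabled B t := fun p hp => (htA p hp).trans (hAB p)
         refine aux_fire_inj N htA htB (ih (α ++ β) _ _ ?_ (aux_fire_le N t hAB) ?_ ?_)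
         · simp at hn ⊢
           omega
         · obtain ⟨ρ, hρ⟩ := hA
           exact ⟨ρ ++ [t], aux_fires_append N hρ (Fires.cons htA (Fires.nil _))⟩
         · refine aux_expedite N _ t β α B hB htB ?_
           intro s hs p h1 h2
           exact aux_disj N hfc (fun e => hα s hs (e.trans htu)) p h1 h2)
    · have hno : ∀ u, N.enabled A u → ∀ s ∈ σ, N.pre s ≠ N.pre u :=
        fun u hu s hs e => hex ⟨u, hu, s, hs, e⟩
      have hkey : (∀ p, clusterMrk C p ≤ A p) := by
        obtain ⟨ρ, hρ⟩ := hh A hA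
        cases hρ with
        | nil => exact fun p => le_rfl
        | @cons _ u ρ _ hu hρ =>
          have hCu : ∀ p ∈ N.pre u, Sum.inl p ∈ C := by
            intro p hpu
            have h1 := aux_fires_mono N (p := p) hB
              (fun s hs h => aux_disj N hfc (hno u hu s hs) p h hpu)
            have h2 := hu p hpu
            have h3 := hAB p
            by_contra hnC
            simp only [clusterMrk, if_neg hnC] at h1
            omega
          obtain ⟨q, hq⟩ := (hp u).1
          intro p
          unfold clusterMrk
          by_cases hpC : Sum.inl p ∈ C
          · rw [if_pos hpC]
            exact hu p ((aux_pre_eq N hfc hC hq (hCu q hq) p).1 hpC)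
          · rw [if_neg hpC]
            exact Nat.zero_le _
      have hnil := aux_nil N hp C hB rfl (fun p => (hkey p).trans (hAB p)) (by
        intro s hs p hps hpC
        refine hno s ?_ s hs rfl
        intro r hr
        have h1 := hkey r
        have h2 : Sum.inl r ∈ C := (aux_pre_eq N hfc hC hps hpC r).2 hr
        simp only [clusterMrk, if_pos h2] at h1
        exact h1)
      subst hnil
      cases hB
      funext p
      exact le_antisymm (hkey p) (hAB p)

end Helpers

end PetriNet

/-- In a marked proper free-choice net with a home cluster C, no
reachable marking strictly dominates Mrk(C). -/
theorem no_dominating_marking {P T : Type} [DecidableEq P]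
    (N : PetriNet P T) (M : P → ℕ) (C : Set (P ⊕ T))
    (hp : N.Proper) (hfc : N.FreeChoice) (hc : N.HomeCluster M C)
    (M' : P → ℕ) (hr : N.Reach M M') (hge : ∀ p, PetriNet.clusterMrk C p ≤ M' p) :
    M' = PetriNet.clusterMrk C := by
  obtain ⟨hC, hh⟩ := hc
  obtain ⟨σ, hσ⟩ := hh M' hr
  obtain ⟨τ, hτ⟩ := hr
  refine PetriNet.aux_main N hp hfc hC ?_ σ.length σ _ _ rfl hge ⟨[], PetriNet.Fires.nil _⟩ hσ
  rintro X ⟨ρ, hρ⟩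
  exact hh X ⟨(τ ++ σ) ++ ρ,
    PetriNet.aux_fires_append N (PetriNet.aux_fires_append N hτ hσ) hρ⟩
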